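/- Let R be an atomic, integrally closed integral domain. Then R has the Z-property if and only if the following holds: whenever f = a₀ + a₁x and g = b₀ + b₁x are primitive polynomials of degree 1 over R and c ∈ R is a constant factor of the product fg (i.e., c divides fg in R[x]), then c is a unit or an irreducible element of R. -/

import Mathlib

/-- An integral domain has the **Z-property** if whenever `a,b,c,d,e` are nonzero
nonunits with `a*b*c = d*e`, then `a*b` and `d` have a common nonunit factor or
`a*b` and `e` have a common nonunit factor. -/
def HasZProperty (R : Type*) [CommRing R] : Prop :=
  ∀ a b c d e : R,
    a ≠ 0 → b ≠ 0 → c ≠ 0 → d ≠ 0 → e ≠ 0 →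
    ¬IsUnit a → ¬IsUnit b → ¬IsUnit c → ¬IsUnit d → ¬IsUnit e →
    a * b * c = d * e →
    (∃ f : R, ¬IsUnit f ∧ f ∣ a * b ∧ f ∣ d) ∨
    (∃ f : R, ¬IsUnit f ∧ f ∣ a * b ∧ f ∣ e)

/-- A domain is **atomic** if every nonzero nonunit is a product of irreducible elements. -/
def IsAtomicDomain (R : Type*) [CommRing R] : Prop :=
  ∀ a : R, a ≠ 0 → ¬IsUnit a →
    ∃ s : Multiset R, (∀ b ∈ s, Irreducible b) ∧ s.prod = a

/-- A **half-factorial domain**: atomic, and any two factorizations of an element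
into irreducibles have the same length. -/
def IsHFD (R : Type*) [CommRing R] : Prop :=
  IsAtomicDomain R ∧
    ∀ s t : Multiset R, (∀ a ∈ s, Irreducible a) → (∀ a ∈ t, Irreducible a) →
      s.prod = t.prod → Multiset.card s = Multiset.card t

section Factorization

variable {R : Type*} [CommRing R]

/-- `s` is a factorization of `x` into irreducible elements, up to a unit. -/
def IsAtomicFactorization (s : Multiset R) (x : R) : Prop :=
  (∀ p ∈ s, Irreducible p) ∧ Associated s.prod x

theorem IsAtomicFactorization.cons {s : Multiset R} {p x : R}
    (hs : IsAtomicFactorization s x) (hp : Irreducible p) :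
    IsAtomicFactorization (p ::ₘ s) (p * x) := by
  refine ⟨fun q hq => ?_, ?_⟩
  · rcases Multiset.mem_cons.1 hq with rfl | hq
    · exact hp
    · exact hs.1 q hq
  · rw [Multiset.prod_cons]
    exact hs.2.mul_left p

theorem IsAtomicFactorization.add {s t : Multiset R} {x y : R}
    (hs : IsAtomicFactorization s x) (ht : IsAtomicFactorization t y) :
    IsAtomicFactorization (s + t) (x * y) := by
  refine ⟨fun q hq => ?_, ?_⟩
  · rcases Multiset.mem_add.1 hq with hq | hq
    · exact hs.1 q hq
    · exact ht.1 q hq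
  · rw [Multiset.prod_add]
    exact hs.2.mul_mul ht.2

theorem IsAtomicFactorization.eq_zero_of_isUnit {s : Multiset R} {x : R}
    (hs : IsAtomicFactorization s x) (hx : IsUnit x) : s = 0 := by
  refine Multiset.eq_zero_of_forall_notMem fun p hp => (hs.1 p hp).not_isUnit ?_
  exact isUnit_of_dvd_unit (Multiset.dvd_prod hp) (hs.2.symm.isUnit hx)

theorem IsAtomicDomain.exists_factorization (hA : IsAtomicDomain R) {x : R} (hx : x ≠ 0) :
    ∃ s, IsAtomicFactorization s x := by
  by_cases hu : IsUnit x
  · exact ⟨0, by simp, by simpa using (associated_one_iff_isUnit.2 hu).symm⟩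
  · obtain ⟨s, hs, rfl⟩ := hA x hx hu
    exact ⟨s, hs, Associated.refl _⟩

theorem IsAtomicDomain.exists_irreducible_dvd (hA : IsAtomicDomain R) {x : R} (hx : x ≠ 0)
    (hu : ¬IsUnit x) : ∃ p, Irreducible p ∧ p ∣ x := by
  obtain ⟨s, hs, rfl⟩ := hA x hx hu
  rcases s.empty_or_exists_mem with rfl | ⟨p, hp⟩
  · simp at hu
  · exact ⟨p, hs p hp, Multiset.dvd_prod hp⟩

/-- An additive length function detecting units, for which an element of length at least two
dividing a product shares a nonunit factor with one of the two terms. -/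
structure IsZLength (ℓ : R → ℕ) : Prop where
  map_mul : ∀ {x y : R}, x ≠ 0 → y ≠ 0 → ℓ (x * y) = ℓ x + ℓ y
  eq_zero_iff : ∀ {x : R}, x ≠ 0 → (ℓ x = 0 ↔ IsUnit x)
  le_one : ∀ {x y z : R}, x ≠ 0 → y ≠ 0 → z ≠ 0 → x ∣ y * z → IsRelPrime x y → IsRelPrime x z →
    ℓ x ≤ 1

/-- Two nonzero elements have a maximal common divisor. -/
theorem IsZLength.exists_isRelPrime {ℓ : R → ℕ} (hℓ : IsZLength ℓ) {x y : R}
    (hx : x ≠ 0) (hy : y ≠ 0) :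
    ∃ d x' y', x = d * x' ∧ y = d * y' ∧ IsRelPrime x' y' := by
  induction hn : ℓ x using Nat.strong_induction_on generalizing x y with
  | _ n ih =>
    by_cases h : IsRelPrime x y
    · exact ⟨1, x, y, by simp, by simp, h⟩
    · simp only [IsRelPrime, not_forall] at h
      obtain ⟨f, ⟨x₁, rfl⟩, ⟨y₁, rfl⟩, hf⟩ := h
      have hf0 := left_ne_zero_of_mul hx
      have hx₁ := right_ne_zero_of_mul hx
      have hfpos : ℓ f ≠ 0 := fun h => hf ((hℓ.eq_zero_iff hf0).1 h)
      have hmul := hℓ.map_mul hf0 hx₁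
      obtain ⟨d, x', y', rfl, rfl, h'⟩ :=
        ih (ℓ x₁) (by omega) hx₁ (right_ne_zero_of_mul hy) rfl
      exact ⟨f * d, x', y', by ring, by ring, h'⟩

theorem IsZLength.isUnit_or_irreducible {ℓ : R → ℕ} (hℓ : IsZLength ℓ) {c : R}
    (hc : c ≠ 0) (h : ℓ c ≤ 1) :
    IsUnit c ∨ Irreducible c := by
  refine or_iff_not_imp_left.2 fun hu => ⟨hu, fun x y hxy => ?_⟩
  subst hxy
  have hx := left_ne_zero_of_mul hc
  have hy := right_ne_zero_of_mul hc
  rw [← hℓ.eq_zero_iff hx, ← hℓ.eq_zero_iff hy]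
  rw [hℓ.map_mul hx hy] at h
  omega

open Polynomial in
theorem C_dvd_linear_mul_linear_iff {a₀ a₁ b₀ b₁ c : R} :
    C c ∣ (C a₀ + C a₁ * X) * (C b₀ + C b₁ * X) ↔
      c ∣ a₀ * b₀ ∧ c ∣ a₀ * b₁ + a₁ * b₀ ∧ c ∣ a₁ * b₁ := by
  have expand : (C a₀ + C a₁ * X) * (C b₀ + C b₁ * X) =
      C (a₁ * b₁) * X ^ 2 + C (a₀ * b₁ + a₁ * b₀) * X + C (a₀ * b₀) := by
    simp only [map_mul, map_add]; ring
  rw [expand]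
  constructor
  · intro h
    rw [C_dvd_iff_dvd_coeff] at h
    have coeffs : ∀ p q r : R, (C p * X ^ 2 + C q * X + C r).coeff 0 = r ∧
        (C p * X ^ 2 + C q * X + C r).coeff 1 = q ∧ (C p * X ^ 2 + C q * X + C r).coeff 2 = p :=
      fun p q r => by simp [coeff_X, coeff_C, coeff_X_pow]
    obtain ⟨h0, h1, h2⟩ := coeffs (a₁ * b₁) (a₀ * b₁ + a₁ * b₀) (a₀ * b₀)
    exact ⟨h0 ▸ h 0, h1 ▸ h 1, h2 ▸ h 2⟩
  · rintro ⟨h0, h1, h2⟩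
    exact dvd_add (dvd_add ((_root_.map_dvd C h2).mul_right _) ((_root_.map_dvd C h1).mul_right _))
      (_root_.map_dvd C h0)

variable [IsDomain R]

/-- With the Z-property, a product of two irreducible elements divided by an irreducible factor
is irreducible. -/
theorem HasZProperty.irreducible_of_mul_eq (hZ : HasZProperty R) {p q y z : R}
    (hp : Irreducible p) (hq : Irreducible q) (hy : Irreducible y) (h : y * z = p * q) :
    Irreducible z := by
  have no_split : ∀ {p q v : R}, Irreducible p → Irreducible q → ¬IsUnit v → ∀ u : R, ¬IsUnit u →
      y * u * v = p * q → (∃ f : R, ¬IsUnit f ∧ f ∣ y * u ∧ f ∣ p) → False := by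
    rintro p q v hp hq hv u hu h ⟨f, hf, hfu, hfp⟩
    have hpf : p ∣ y * u := ((hp.dvd_iff.1 hfp).resolve_left hf).dvd.trans hfu
    obtain ⟨w, hw⟩ := hpf
    have hwv : w * v = q := by
      apply mul_left_cancel₀ hp.ne_zero
      rw [← h, hw]; ring
    have hw1 : IsUnit w := (hq.isUnit_or_isUnit hwv.symm).resolve_right hv
    have : Irreducible (y * u) := by
      rw [hw]; exact (irreducible_mul_isUnit hw1).2 hp
    exact (this.isUnit_or_isUnit rfl).elim hy.not_isUnit hu
  refine ⟨fun hz => ?_, fun u v huv => ?_⟩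
  · have : Irreducible (p * q) := by
      rw [← h]; exact (irreducible_mul_isUnit hz).2 hy
    exact (this.isUnit_or_isUnit rfl).elim hp.not_isUnit hq.not_isUnit
  · by_contra! hcon
    obtain ⟨hu, hv⟩ := hcon
    have hz0 : z ≠ 0 := right_ne_zero_of_mul (h ▸ mul_ne_zero hp.ne_zero hq.ne_zero)
    have h' : y * u * v = p * q := by rw [← h, huv]; ring
    rcases hZ y u v p q hy.ne_zero (left_ne_zero_of_mul (huv ▸ hz0))
      (right_ne_zero_of_mul (huv ▸ hz0)) hp.ne_zero hq.ne_zero hy.not_isUnit hu hv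
      hp.not_isUnit hq.not_isUnit h' with hf | hf
    · exact no_split hp hq hv u hu h' hf
    · exact no_split hq hp hv u hu (h'.trans (mul_comm p q)) hf

theorem HasZProperty.card_le_card (hZ : HasZProperty R) (hA : IsAtomicDomain R) (n : ℕ) :
    ∀ (s t : Multiset R) (x : R), IsAtomicFactorization s x → IsAtomicFactorization t x →
      Multiset.card t ≤ n → Multiset.card s ≤ Multiset.card t := by
  induction n with
  | zero =>
    intro s t x hs ht hn
    obtain rfl : t = 0 := Multiset.card_eq_zero.1 (Nat.le_zero.1 hn)
    have : s = 0 := hs.eq_zero_of_isUnit (ht.2.isUnit (by simp))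
    simp [this]
  | succ n ih =>
    intro s t x hs ht hn
    by_contra! hlt
    rcases t.empty_or_exists_mem with rfl | ⟨q, hqt⟩
    · have : s = 0 := hs.eq_zero_of_isUnit (ht.2.isUnit (by simp))
      simp [this] at hlt
    obtain ⟨t, rfl⟩ := Multiset.exists_cons_of_mem hqt
    have hq : Irreducible q := ht.1 q hqt
    have htirr : ∀ p ∈ t, Irreducible p := fun p hp => ht.1 p (Multiset.mem_cons_of_mem hp)
    rw [Multiset.card_cons] at hn hlt
    obtain ⟨p₁, hp₁s⟩ := Multiset.card_pos_iff_exists_mem.1 (by omega : 0 < Multiset.card s)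
    obtain ⟨s, rfl⟩ := Multiset.exists_cons_of_mem hp₁s
    rw [Multiset.card_cons] at hlt
    obtain ⟨p₂, hp₂s⟩ := Multiset.card_pos_iff_exists_mem.1 (by omega : 0 < Multiset.card s)
    obtain ⟨s, rfl⟩ := Multiset.exists_cons_of_mem hp₂s
    rw [Multiset.card_cons] at hlt
    have hp₁ : Irreducible p₁ := hs.1 p₁ hp₁s
    have hp₂ : Irreducible p₂ := hs.1 p₂ (Multiset.mem_cons_of_mem hp₂s)
    have hsirr : ∀ p ∈ s, Irreducible p := fun p hp =>
      hs.1 p (Multiset.mem_cons_of_mem (Multiset.mem_cons_of_mem hp))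
    obtain ⟨u, hu⟩ := hs.2.trans ht.2.symm
    simp only [Multiset.prod_cons] at hu
    set S : R := s.prod * u with hS
    have hsS : IsAtomicFactorization s S := ⟨hsirr, ⟨u, rfl⟩⟩
    have hST : p₁ * p₂ * S = q * t.prod := by rw [← hu, hS]; ring
    have ht0 : t.prod ≠ 0 := Multiset.prod_ne_zero fun h => (htirr 0 h).ne_zero rfl
    have hS0 : S ≠ 0 := right_ne_zero_of_mul (hST ▸ mul_ne_zero hq.ne_zero ht0)
    have htt : IsAtomicFactorization t t.prod := ⟨htirr, Associated.refl _⟩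
    have hp12 : p₁ * p₂ ≠ 0 := mul_ne_zero hp₁.ne_zero hp₂.ne_zero
    -- an irreducible common factor of `p₁ * p₂` and `q` can be cancelled
    have cancel_q : ∀ f : R, ¬IsUnit f → f ∣ p₁ * p₂ → f ∣ q → False := by
      intro f hf hfp hfq
      obtain ⟨z, hz⟩ : q ∣ p₁ * p₂ := ((hq.dvd_iff.1 hfq).resolve_left hf).dvd.trans hfp
      have hzi := hZ.irreducible_of_mul_eq hp₁ hp₂ hq hz.symm
      have hzS : z * S = t.prod := by
        apply mul_left_cancel₀ hq.ne_zero
        rw [← hST, hz]; ring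
      have := ih _ _ _ (hzS ▸ hsS.cons hzi) htt (by omega)
      rw [Multiset.card_cons] at this
      omega
    have hSu : ¬IsUnit S := by
      intro hSu
      obtain rfl := hsS.eq_zero_of_isUnit hSu
      have ht' : t = 0 := by
        rw [← Multiset.card_eq_zero]; rw [Multiset.card_zero] at hlt; omega
      subst ht'
      refine cancel_q p₁ hp₁.not_isUnit (dvd_mul_right _ _) ?_
      have : p₁ ∣ q * (0 : Multiset R).prod := hST ▸ (dvd_mul_right p₁ p₂).mul_right S
      simpa using this
    have htu : ¬IsUnit t.prod := by
      intro htu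
      have hdvd : p₁ ∣ q * t.prod := hST ▸ (dvd_mul_right p₁ p₂).mul_right S
      exact cancel_q p₁ hp₁.not_isUnit (dvd_mul_right _ _) (htu.dvd_mul_right.1 hdvd)
    rcases hZ p₁ p₂ S q t.prod hp₁.ne_zero hp₂.ne_zero hS0 hq.ne_zero ht0 hp₁.not_isUnit
      hp₂.not_isUnit hSu hq.not_isUnit htu hST with ⟨f, hf, hfp, hfq⟩ | ⟨f, hf, hfp, hft⟩
    · exact cancel_q f hf hfp hfq
    · obtain ⟨y, hy, hyf⟩ := hA.exists_irreducible_dvd (ne_zero_of_dvd_ne_zero ht0 hft) hf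
      obtain ⟨z, hz⟩ := hyf.trans hfp
      obtain ⟨w, hw⟩ := hyf.trans hft
      have hzi := hZ.irreducible_of_mul_eq hp₁ hp₂ hy hz.symm
      obtain ⟨W, hW⟩ := hA.exists_factorization (right_ne_zero_of_mul (hw ▸ ht0))
      have hWt := ih _ _ _ (hw ▸ hW.cons hy) htt (by omega)
      rw [Multiset.card_cons] at hWt
      have hzS : z * S = q * w := by
        apply mul_left_cancel₀ hy.ne_zero
        calc y * (z * S) = p₁ * p₂ * S := by rw [hz]; ring
          _ = y * (q * w) := by rw [hST, hw]; ring
      have := ih _ _ _ (hzS ▸ hsS.cons hzi) (hW.cons hq) (by rw [Multiset.card_cons]; omega)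
      simp only [Multiset.card_cons] at this
      omega

theorem HasZProperty.exists_isZLength (hZ : HasZProperty R) (hA : IsAtomicDomain R) :
    ∃ ℓ : R → ℕ, IsZLength ℓ := by
  classical
  choose! F hF using fun (x : R) (hx : x ≠ 0) => hA.exists_factorization hx
  have card_eq : ∀ {s : Multiset R} {x : R}, x ≠ 0 → IsAtomicFactorization s x →
      Multiset.card (F x) = Multiset.card s := fun hx hs =>
    le_antisymm (hZ.card_le_card hA _ _ _ _ (hF _ hx) hs le_rfl)
      (hZ.card_le_card hA _ _ _ _ hs (hF _ hx) le_rfl)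
  have map_mul : ∀ {x y : R}, x ≠ 0 → y ≠ 0 →
      Multiset.card (F (x * y)) = Multiset.card (F x) + Multiset.card (F y) := by
    intro x y hx hy
    rw [card_eq (mul_ne_zero hx hy) ((hF x hx).add (hF y hy)), Multiset.card_add]
  have eq_zero_iff : ∀ {x : R}, x ≠ 0 → (Multiset.card (F x) = 0 ↔ IsUnit x) := by
    refine fun {x} hx => ⟨fun h => ?_, fun h => ?_⟩
    · have := (hF x hx).2
      rw [Multiset.card_eq_zero.1 h] at this
      exact this.isUnit (by simp)
    · rw [(hF x hx).eq_zero_of_isUnit h, Multiset.card_zero]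
  refine ⟨fun x => Multiset.card (F x), map_mul, eq_zero_iff, ?_⟩
  intro x y z hx hy hz hdvd hxy hxz
  by_contra! hlt
  have hxu : ¬IsUnit x := fun h => by rw [(eq_zero_iff hx).2 h] at hlt; omega
  obtain ⟨p, hp, q, rfl⟩ := hA.exists_irreducible_dvd hx hxu
  have hq0 : q ≠ 0 := right_ne_zero_of_mul hx
  have hqu : ¬IsUnit q := by
    intro hq
    have : Multiset.card (F (p * q)) = Multiset.card ({p} : Multiset R) :=
      card_eq hx ⟨by simpa using hp, by simpa using (associated_mul_unit_right p q hq)⟩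
    simp only [Multiset.card_singleton] at this
    omega
  obtain ⟨w, hw⟩ := hdvd
  have hw0 : w ≠ 0 := right_ne_zero_of_mul (hw ▸ mul_ne_zero hy hz)
  have hyu : ¬IsUnit y := fun h =>
    hxu (hxz dvd_rfl (h.dvd_mul_left.1 ⟨w, hw⟩))
  have hzu : ¬IsUnit z := fun h =>
    hxu (hxy dvd_rfl (h.dvd_mul_right.1 ⟨w, hw⟩))
  have hwu : ¬IsUnit w := fun h =>
    hyu (hxy (h.dvd_mul_right.1 (hw ▸ dvd_mul_right y z)) dvd_rfl)
  rcases hZ p q w y z hp.ne_zero hq0 hw0 hy hz hp.not_isUnit hqu hwu hyu hzu hw.symm with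
    ⟨f, hf, h1, h2⟩ | ⟨f, hf, h1, h2⟩
  · exact hf (hxy h1 h2)
  · exact hf (hxz h1 h2)

namespace IsZLength

variable {ℓ : R → ℕ}

/-- A constant factor of `b • (a₀, a₁)`, with `a₀, a₁` relatively prime, that is relatively prime
to `b` has length at most one. -/
theorem le_one_of_dvd_of_isRelPrime (hℓ : IsZLength ℓ) {a₀ a₁ b c h₀ h₁ : R} (ha₀ : a₀ ≠ 0)
    (ha₁ : a₁ ≠ 0) (hb : b ≠ 0) (e₀ : a₀ * b = c * h₀) (e₁ : a₁ * b = c * h₁)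
    (ha : IsRelPrime a₀ a₁) (hcb : IsRelPrime c b) : ℓ c ≤ 1 := by
  have hc : c ≠ 0 := left_ne_zero_of_mul (e₀ ▸ mul_ne_zero ha₀ hb)
  have hh₀ : h₀ ≠ 0 := right_ne_zero_of_mul (e₀ ▸ mul_ne_zero ha₀ hb)
  obtain ⟨y, α, η, rfl, rfl, hαη⟩ := hℓ.exists_isRelPrime ha₀ hh₀
  have hy := left_ne_zero_of_mul ha₀
  have hα := right_ne_zero_of_mul ha₀
  have hη := right_ne_zero_of_mul hh₀
  have eα : α * b = c * η := mul_left_cancel₀ hy (by linear_combination e₀)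
  have eα₁ : a₁ * η = α * h₁ :=
    mul_left_cancel₀ hc (by linear_combination α * e₁ - a₁ * eα)
  have hαle : ℓ α ≤ 1 := hℓ.le_one hα ha₁ hη ⟨h₁, eα₁⟩ ha.of_mul_left_right hαη
  by_contra! hlt
  have hcα : ¬IsRelPrime c α := fun h =>
    absurd (hℓ.le_one hc hα hb ⟨η, eα⟩ h hcb) (by omega)
  simp only [IsRelPrime, not_forall] at hcα
  obtain ⟨f, hfc, ⟨v, rfl⟩, hf⟩ := hcα
  have hf0 := left_ne_zero_of_mul hα
  have hv0 := right_ne_zero_of_mul hα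
  have hfpos : ℓ f ≠ 0 := fun h => hf ((hℓ.eq_zero_iff hf0).1 h)
  have hfv := hℓ.map_mul hf0 hv0
  have hv : IsUnit v := (hℓ.eq_zero_iff hv0).1 (by omega)
  obtain ⟨c', rfl⟩ : f * v ∣ c := hv.mul_right_dvd.2 hfc
  have eb : b = c' * η := mul_left_cancel₀ hα (by linear_combination eα)
  have hc' : IsUnit c' := hcb (dvd_mul_left _ _) ⟨η, eb⟩
  have hc'0 := right_ne_zero_of_mul hc
  have := hℓ.map_mul hα hc'0
  have := (hℓ.eq_zero_iff hc'0).2 hc'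
  omega

/-- Proportional relatively prime pairs have a ratio of length zero. -/
theorem eq_of_mul_eq_mul (hℓ : IsZLength ℓ) {a b₀ b₁ c k₀ k₁ : R} (ha : a ≠ 0) (hc : c ≠ 0)
    (hb₀ : b₀ ≠ 0) (hb₁ : b₁ ≠ 0) (e₀ : a * b₀ = c * k₀) (e₁ : a * b₁ = c * k₁)
    (hb : IsRelPrime b₀ b₁) (hk : IsRelPrime k₀ k₁) : ℓ a = ℓ c := by
  obtain ⟨g, c', a', rfl, rfl, hca⟩ := hℓ.exists_isRelPrime hc ha
  have hg := left_ne_zero_of_mul hc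
  have hc' := right_ne_zero_of_mul hc
  have ha' := right_ne_zero_of_mul ha
  have e₀' : a' * b₀ = c' * k₀ := mul_left_cancel₀ hg (by linear_combination e₀)
  have e₁' : a' * b₁ = c' * k₁ := mul_left_cancel₀ hg (by linear_combination e₁)
  have hk₀ : k₀ ≠ 0 := right_ne_zero_of_mul (e₀' ▸ mul_ne_zero ha' hb₀)
  have hk₁ : k₁ ≠ 0 := right_ne_zero_of_mul (e₁' ▸ mul_ne_zero ha' hb₁)
  have hc1 : ℓ c' ≤ 1 := hℓ.le_one_of_dvd_of_isRelPrime hb₀ hb₁ ha'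
    ((mul_comm _ _).trans e₀') ((mul_comm _ _).trans e₁') hb hca
  have ha1 : ℓ a' ≤ 1 := hℓ.le_one_of_dvd_of_isRelPrime hk₀ hk₁ hc'
    ((mul_comm _ _).trans e₀'.symm) ((mul_comm _ _).trans e₁'.symm) hk hca.symm
  have hunit : IsUnit a' ↔ IsUnit c' :=
    ⟨fun h => hb (h.dvd_mul_left.1 ⟨k₀, e₀'⟩) (h.dvd_mul_left.1 ⟨k₁, e₁'⟩),
      fun h => hk (h.dvd_mul_left.1 ⟨b₀, e₀'.symm⟩) (h.dvd_mul_left.1 ⟨b₁, e₁'.symm⟩)⟩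
  rw [← hℓ.eq_zero_iff ha', ← hℓ.eq_zero_iff hc'] at hunit
  rw [hℓ.map_mul hg ha', hℓ.map_mul hg hc']
  omega

theorem add_le_of_mul_eq_mul (hℓ : IsZLength ℓ) {a b₀ b₁ c s k₀ k₁ : R} (ha : a ≠ 0) (hb₀ : b₀ ≠ 0)
    (hb₁ : b₁ ≠ 0) (e₀ : a * b₀ = c * (s * k₀)) (e₁ : a * b₁ = c * (s * k₁))
    (hb : IsRelPrime b₀ b₁) : ℓ c + ℓ s ≤ ℓ a := by
  have h₀ := e₀ ▸ mul_ne_zero ha hb₀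
  have h₁ := e₁ ▸ mul_ne_zero ha hb₁
  have hc := left_ne_zero_of_mul h₀
  have hs := left_ne_zero_of_mul (right_ne_zero_of_mul h₀)
  have hk₀ := right_ne_zero_of_mul (right_ne_zero_of_mul h₀)
  have hk₁ := right_ne_zero_of_mul (right_ne_zero_of_mul h₁)
  obtain ⟨r, m₀, m₁, rfl, rfl, hm⟩ := hℓ.exists_isRelPrime hk₀ hk₁
  have hr := left_ne_zero_of_mul hk₀
  have hcs := mul_ne_zero hc hs
  have := hℓ.eq_of_mul_eq_mul (c := c * s * r) (k₀ := m₀) (k₁ := m₁) ha (mul_ne_zero hcs hr)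
    hb₀ hb₁ (by linear_combination e₀) (by linear_combination e₁) hb hm
  rw [hℓ.map_mul hcs hr, hℓ.map_mul hc hs] at this
  omega

/-- A common divisor of all products of entries of two relatively prime pairs has length at most
one. -/
theorem le_one_of_forall_dvd (hℓ : IsZLength ℓ) {a₀ a₁ b₀ b₁ c : R} (ha₀ : a₀ ≠ 0) (ha₁ : a₁ ≠ 0)
    (hb₀ : b₀ ≠ 0) (hb₁ : b₁ ≠ 0) (ha : IsRelPrime a₀ a₁) (hb : IsRelPrime b₀ b₁)
    (h₀₀ : c ∣ a₀ * b₀) (h₀₁ : c ∣ a₀ * b₁) (h₁₀ : c ∣ a₁ * b₀) (h₁₁ : c ∣ a₁ * b₁) :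
    ℓ c ≤ 1 := by
  obtain ⟨x₀₀, e₀₀⟩ := h₀₀
  obtain ⟨x₀₁, e₀₁⟩ := h₀₁
  obtain ⟨x₁₀, e₁₀⟩ := h₁₀
  obtain ⟨x₁₁, e₁₁⟩ := h₁₁
  have hc : c ≠ 0 := left_ne_zero_of_mul (e₀₀ ▸ mul_ne_zero ha₀ hb₀)
  have hx₀₀ : x₀₀ ≠ 0 := right_ne_zero_of_mul (e₀₀ ▸ mul_ne_zero ha₀ hb₀)
  have hx₀₁ : x₀₁ ≠ 0 := right_ne_zero_of_mul (e₀₁ ▸ mul_ne_zero ha₀ hb₁)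
  have hx₁₀ : x₁₀ ≠ 0 := right_ne_zero_of_mul (e₁₀ ▸ mul_ne_zero ha₁ hb₀)
  have hx₁₁ : x₁₁ ≠ 0 := right_ne_zero_of_mul (e₁₁ ▸ mul_ne_zero ha₁ hb₁)
  have hdet : x₀₀ * x₁₁ = x₀₁ * x₁₀ := by
    apply mul_left_cancel₀ (mul_ne_zero hc hc)
    linear_combination -(c * x₁₁) * e₀₀ - a₀ * b₀ * e₁₁ + (c * x₁₀) * e₀₁ + a₀ * b₁ * e₁₀
  obtain ⟨r₀, k₀₀, k₀₁, rfl, rfl, hk₀⟩ := hℓ.exists_isRelPrime hx₀₀ hx₀₁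
  obtain ⟨r₁, k₁₀, k₁₁, rfl, rfl, -⟩ := hℓ.exists_isRelPrime hx₁₀ hx₁₁
  have hr₀ := left_ne_zero_of_mul hx₀₀
  have hr₁ := left_ne_zero_of_mul hx₁₀
  have hk₀₀ := right_ne_zero_of_mul hx₀₀
  have hk₀₁ := right_ne_zero_of_mul hx₀₁
  have hk₁₀ := right_ne_zero_of_mul hx₁₀
  have hrow : ℓ a₀ = ℓ (c * r₀) := hℓ.eq_of_mul_eq_mul ha₀ (mul_ne_zero hc hr₀) hb₀ hb₁
    (by linear_combination e₀₀) (by linear_combination e₀₁) hb hk₀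
  have hlen := congrArg ℓ e₀₀
  rw [hℓ.map_mul ha₀ hb₀, hrow, hℓ.map_mul hc hr₀, hℓ.map_mul hc hx₀₀,
    hℓ.map_mul hr₀ hk₀₀] at hlen
  obtain ⟨s, m₀, m₁, rfl, rfl, hm⟩ := hℓ.exists_isRelPrime hk₀₀ hk₁₀
  have hs := left_ne_zero_of_mul hk₀₀
  have hm₀ := right_ne_zero_of_mul hk₀₀
  have hm₁ := right_ne_zero_of_mul hk₁₀
  have hdet' : m₁ * k₀₁ = m₀ * k₁₁ := by
    apply mul_left_cancel₀ (mul_ne_zero (mul_ne_zero hr₀ hr₁) hs)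
    linear_combination -hdet
  have hm₀le : ℓ m₀ ≤ 1 := hℓ.le_one hm₀ hm₁ hk₀₁ ⟨k₁₁, hdet'⟩ hm hk₀.of_mul_left_right
  have hcol : ℓ c + ℓ s ≤ ℓ b₀ := hℓ.add_le_of_mul_eq_mul (k₀ := r₀ * m₀) (k₁ := r₁ * m₁) hb₀ ha₀
    ha₁ (by linear_combination e₀₀) (by linear_combination e₁₀) ha
  rw [hℓ.map_mul hs hm₀] at hlen
  omega

end IsZLength

/-- In an integrally closed domain, if `c` divides `u + v` and `c ^ 2` divides `u * v`, then `c`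
divides `u`. -/
theorem IsIntegrallyClosed.dvd_of_dvd_add_of_sq_dvd_mul [IsIntegrallyClosed R] {c u v : R}
    (hc : c ≠ 0) (hadd : c ∣ u + v) (hmul : c ^ 2 ∣ u * v) : c ∣ u := by
  obtain ⟨s, hs⟩ := hadd
  obtain ⟨p, hp⟩ := hmul
  have hcK : algebraMap R (FractionRing R) c ≠ 0 := by simpa using hc
  have hint : IsIntegral R (algebraMap R (FractionRing R) u / algebraMap R (FractionRing R) c) := by
    refine ⟨Polynomial.X ^ 2 + (Polynomial.C (-s) * Polynomial.X + Polynomial.C p),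
      Polynomial.monic_X_pow_add ?_, ?_⟩
    · exact (Polynomial.degree_linear_le).trans_lt (by norm_num)
    · have hs' := congrArg (algebraMap R (FractionRing R)) hs
      have hp' := congrArg (algebraMap R (FractionRing R)) hp
      simp only [map_add, map_mul, map_pow] at hs' hp'
      simp only [Polynomial.eval₂_add, Polynomial.eval₂_pow, Polynomial.eval₂_X,
        Polynomial.eval₂_mul, Polynomial.eval₂_C]
      rw [map_neg]
      field_simp
      linear_combination -hp' + algebraMap R (FractionRing R) u * hs'
  obtain ⟨w, hw⟩ := IsIntegrallyClosed.isIntegral_iff.1 hint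
  refine ⟨w, IsFractionRing.injective R (FractionRing R) ?_⟩
  rw [map_mul, hw]
  field_simp

end Factorization

/-- For an atomic, integrally closed integral domain `R`, the
Z-property holds iff every constant factor of a product of two primitive degree-one
polynomials is a unit or irreducible. -/
theorem zproperty_iff_constant_factor (R : Type*) [CommRing R] [IsDomain R]
    (hAtomic : IsAtomicDomain R) (hIC : IsIntegrallyClosed R) :
    HasZProperty R ↔
      ∀ a₀ a₁ b₀ b₁ : R, a₁ ≠ 0 → b₁ ≠ 0 →
        (∀ r : R, r ∣ a₀ → r ∣ a₁ → IsUnit r) →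
        (∀ r : R, r ∣ b₀ → r ∣ b₁ → IsUnit r) →
        ∀ c : R,
          (Polynomial.C c ∣
            (Polynomial.C a₀ + Polynomial.C a₁ * Polynomial.X) *
              (Polynomial.C b₀ + Polynomial.C b₁ * Polynomial.X)) →
          IsUnit c ∨ Irreducible c := by
  constructor
  · intro hZ a₀ a₁ b₀ b₁ ha₁ hb₁ ha hb c hdvd
    obtain ⟨h₀₀, hadd, h₁₁⟩ := C_dvd_linear_mul_linear_iff.1 hdvd
    have hc : c ≠ 0 := by
      rintro rfl
      exact mul_ne_zero ha₁ hb₁ (zero_dvd_iff.1 h₁₁)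
    have h₀₁ : c ∣ a₀ * b₁ := by
      refine hIC.dvd_of_dvd_add_of_sq_dvd_mul hc hadd ?_
      have := mul_dvd_mul h₀₀ h₁₁
      rwa [← sq, show a₀ * b₀ * (a₁ * b₁) = a₀ * b₁ * (a₁ * b₀) by ring] at this
    have h₁₀ : c ∣ a₁ * b₀ := (dvd_add_right h₀₁).1 hadd
    by_cases ha₀ : a₀ = 0
    · have hu : IsUnit a₁ := ha a₁ (ha₀ ▸ dvd_zero _) dvd_rfl
      exact .inl (hb c (hu.dvd_mul_left.1 h₁₀) (hu.dvd_mul_left.1 h₁₁))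
    by_cases hb₀ : b₀ = 0
    · have hu : IsUnit b₁ := hb b₁ (hb₀ ▸ dvd_zero _) dvd_rfl
      exact .inl (ha c (hu.dvd_mul_right.1 h₀₁) (hu.dvd_mul_right.1 h₁₁))
    obtain ⟨ℓ, hℓ⟩ := hZ.exists_isZLength hAtomic
    exact hℓ.isUnit_or_irreducible hc (hℓ.le_one_of_forall_dvd ha₀ ha₁ hb₀ hb₁
      (fun r h h' => ha r h h') (fun r h h' => hb r h h') h₀₀ h₀₁ h₁₀ h₁₁)
  · intro H a b c d e _ _ _ hd he hau hbu _ _ _ habc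
    by_contra! hcon
    obtain ⟨hD, hE⟩ := hcon
    have hdvd : Polynomial.C (a * b) ∣
        (Polynomial.C (a * b) + Polynomial.C d * Polynomial.X) *
          (Polynomial.C (a * b) + Polynomial.C e * Polynomial.X) :=
      C_dvd_linear_mul_linear_iff.2 ⟨dvd_mul_right _ _,
        dvd_add (dvd_mul_right _ _) (dvd_mul_left _ _), ⟨c, habc.symm⟩⟩
    rcases H (a * b) d (a * b) e hd he
      (fun r h h' => by_contra fun hr => hD r hr h h')
      (fun r h h' => by_contra fun hr => hE r hr h h') (a * b) hdvd with hu | hi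
    · exact hau (isUnit_of_mul_isUnit_left hu)
    · exact (hi.isUnit_or_isUnit rfl).elim hau hbu
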